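/- Coercivity of the space-time least-squares bilinear form (Lemma 3.2): if v is smooth on the closure of Ω×(0,T), v = 0 on ∂Ω × [0,T] and v(·,0) = 0 on Ω, then A(v,v) ≥ ‖v‖²_{V₀}; more precisely, A(v,v) = ∫₀ᵀ∫_Ω |∂_t v|² dx dt + ∫₀ᵀ∫_Ω |Δv|² dx dt + ∫_Ω |∇v(x,T)|² dx. -/

import Mathlib

open MeasureTheory

/-- Partial derivative in the `k`-th spatial direction. -/
noncomputable def pdx {d : ℕ} (k : Fin d) (u : (Fin d → ℝ) → ℝ) (x : Fin d → ℝ) : ℝ :=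
  fderiv ℝ u x (Pi.single k 1)

/-- Spatial Laplacian. -/
noncomputable def lapx {d : ℕ} (u : (Fin d → ℝ) → ℝ) (x : Fin d → ℝ) : ℝ :=
  ∑ k : Fin d, pdx k (pdx k u) x

/-- Time derivative. -/
noncomputable def pdt {d : ℕ} (v : (Fin d → ℝ) → ℝ → ℝ) (x : Fin d → ℝ) (t : ℝ) : ℝ :=
  deriv (v x) t

/-- Squared norm of the spatial gradient. -/
noncomputable def gradSq {d : ℕ} (u : (Fin d → ℝ) → ℝ) (x : Fin d → ℝ) : ℝ :=
  ∑ k : Fin d, (pdx k u x) ^ 2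

/-- The squared `V₀`-norm:  ∫₀ᵀ∫_Ω |Δv|² + ∫₀ᵀ∫_Ω |∂ₜv|². -/
noncomputable def Vsq {d : ℕ} (Ω : Set (Fin d → ℝ)) (T : ℝ)
    (v : (Fin d → ℝ) → ℝ → ℝ) : ℝ :=
  (∫ t in Set.Ioo (0:ℝ) T, ∫ x in Ω, (lapx (fun y => v y t) x) ^ 2)
    + ∫ t in Set.Ioo (0:ℝ) T, ∫ x in Ω, (pdt v x t) ^ 2

/-- The space-time least-squares bilinear form `A`. -/
noncomputable def Abil {d : ℕ} (Ω : Set (Fin d → ℝ)) (T : ℝ)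
    (v w : (Fin d → ℝ) → ℝ → ℝ) : ℝ :=
  ∫ t in Set.Ioo (0:ℝ) T, ∫ x in Ω,
    (pdt v x t * pdt w x t + lapx (fun y => v y t) x * lapx (fun y => w y t) x
      - pdt v x t * lapx (fun y => w y t) x - lapx (fun y => v y t) x * pdt w x t)

section ZeroBoundary

variable {E : Type*} [NormedAddCommGroup E] [NormedSpace ℝ E]

theorem lipschitzWith_indicator_of_eq_zero_on_frontier {g : E → ℝ} {C : NNReal}
    (hg : LipschitzWith C g) {s : Set E} (hs : IsOpen s) (h0 : ∀ x ∈ frontier s, g x = 0) :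
    LipschitzWith C (s.indicator g) := by
  have key : ∀ x ∈ s, ∀ y ∉ s, |g x| ≤ C * dist x y := by
    intro x hx y hy
    obtain ⟨z, hz, hzs⟩ : ∃ z ∈ segment ℝ x y, z ∈ frontier s := by
      by_contra! H
      obtain ⟨w, -, hw, hw'⟩ := (convex_segment x y).isPreconnected s (closure s)ᶜ hs
        isClosed_closure.isOpen_compl
        (fun z hz => by
          by_cases hzs : z ∈ s
          · exact Or.inl hzs
          · refine Or.inr fun hc => H z hz ?_
            rw [hs.frontier_eq]
            exact ⟨hc, hzs⟩)
        ⟨x, left_mem_segment ℝ x y, hx⟩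
        ⟨y, right_mem_segment ℝ x y, fun hc => H y (right_mem_segment ℝ x y) (by
          rw [hs.frontier_eq]
          exact ⟨hc, hy⟩)⟩
      exact hw' (subset_closure hw)
    have h1 := hg.dist_le_mul x z
    rw [h0 z hzs, Real.dist_eq, sub_zero] at h1
    have h2 : dist x z ≤ dist x y := by
      have := dist_add_dist_of_mem_segment hz
      have := dist_nonneg (x := z) (y := y)
      linarith
    exact h1.trans (by gcongr)
  refine LipschitzWith.of_dist_le_mul fun x y => ?_
  by_cases hx : x ∈ s <;> by_cases hy : y ∈ s
  · simpa [hx, hy] using hg.dist_le_mul x y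
  · simpa [hx, hy] using key x hx y hy
  · simpa [hx, hy, dist_comm x y] using key y hy x hx
  · simp only [hx, hy, not_false_eq_true, Set.indicator_of_notMem, dist_self]
    positivity

variable [FiniteDimensional ℝ E] [MeasurableSpace E] [BorelSpace E]
  (μ : Measure E)
  [Measure.IsAddHaarMeasure μ]

theorem ae_fderiv_eq_zero_of_eq_zero_on {f : E → ℝ} {s : Set E} (hs : MeasurableSet s)
    (h0 : ∀ x ∈ s, f x = 0) (hd : ∀ᵐ x ∂μ, DifferentiableAt ℝ f x) :
    ∀ᵐ x ∂μ, x ∈ s → fderiv ℝ f x = 0 := by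
  by_cases hE : ∀ e : E, e = 0
  · refine Filter.Eventually.of_forall fun x _ => ?_
    ext e
    simp [hE e]
  push Not at hE
  obtain ⟨e, he⟩ := hE
  let t := s ∩ {x | DifferentiableAt ℝ f x}
  have ht : MeasurableSet t := hs.inter (measurableSet_of_differentiableAt ℝ f)
  have happ : ApproximatesLinearOn (fun x => f x • e) (0 : E →L[ℝ] E) t 0 := by
    intro x hx y hy
    simp [h0 x hx.1, h0 y hy.1]
  have := happ.norm_fderiv_sub_le μ ht (fun x => (fderiv ℝ f x).smulRight e)
    (fun x hx => (hx.2.hasFDerivAt.smul_const e).hasFDerivWithinAt)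
  rw [ae_restrict_iff' ht] at this
  filter_upwards [this, hd] with x hx hdx hxs
  have h1 := hx ⟨hxs, hdx⟩
  simp only [sub_zero, nonpos_iff_eq_zero, nnnorm_eq_zero] at h1
  ext w
  have h2 := congrArg (fun L : E →L[ℝ] E => L w) h1
  simpa [he] using h2

theorem integral_fderiv_eq_zero_of_eq_zero_on_frontier {g : E → ℝ} (hg : ContDiff ℝ 1 g)
    {s : Set E} (hs : IsOpen s) (hb : Bornology.IsBounded s) (h0 : ∀ x ∈ frontier s, g x = 0)
    (e : E) : ∫ x in s, fderiv ℝ g x e ∂μ = 0 := by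
  obtain ⟨R, hR, hsR⟩ := hb.subset_closedBall_lt 0 (0 : E)
  let χ : ContDiffBump (0 : E) := ⟨R, R + 1, hR, by linarith⟩
  have hχ1 : ∀ x ∈ s, χ x = 1 := fun x hx => χ.one_of_mem_closedBall (hsR hx)
  have hχC : ContDiff ℝ 1 χ := χ.contDiff
  obtain ⟨D, hD⟩ := hχC.lipschitzWith_of_hasCompactSupport χ.hasCompactSupport one_ne_zero
  obtain ⟨C, hC⟩ := (hχC.mul hg).lipschitzWith_of_hasCompactSupport
    χ.hasCompactSupport.mul_right one_ne_zero
  have hL := lipschitzWith_indicator_of_eq_zero_on_frontier hC hs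
    (fun x hx => by simp [h0 x hx])
  set h := s.indicator ((χ : E → ℝ) * g)
  have hsn : ∀ x ∈ s, s ∈ nhds x := fun x hx => hs.mem_nhds hx
  have hparts := hL.integral_lineDeriv_mul_eq (μ := μ) hD χ.hasCompactSupport e
  have hright : ∀ x, lineDeriv ℝ χ x (-e) * h x = 0 := by
    intro x
    by_cases hx : x ∈ s
    · have : (χ : E → ℝ) =ᶠ[nhds x] fun _ => 1 :=
        Filter.eventually_of_mem (hsn x hx) hχ1
      rw [(hχC.differentiable one_ne_zero x).lineDeriv_eq_fderiv, this.fderiv_eq]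
      simp
    · simp [h, hx]
  have hleft : ∀ᵐ x ∂μ, lineDeriv ℝ h x e * χ x = s.indicator (fun x => fderiv ℝ g x e) x := by
    filter_upwards [hL.ae_differentiableAt (μ := μ),
      ae_fderiv_eq_zero_of_eq_zero_on μ hs.measurableSet.compl
        (fun x hx => Set.indicator_of_notMem hx _) (hL.ae_differentiableAt (μ := μ))] with x hd hz
    rw [hd.lineDeriv_eq_fderiv]
    by_cases hx : x ∈ s
    · have : h =ᶠ[nhds x] g :=
        Filter.eventually_of_mem (hsn x hx) fun y hy => by simp [h, hy, hχ1 y hy]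
      rw [this.fderiv_eq]
      simp [hx, hχ1 x hx]
    · have := hz hx
      rw [show fderiv ℝ h x = 0 from this]
      simp [hx]
  rw [integral_congr_ae hleft, integral_indicator hs.measurableSet] at hparts
  simpa [hright] using hparts

end ZeroBoundary

section SpaceTimeSlices

variable {d : ℕ}

theorem contDiff_fderiv_apply {E : Type*} [NormedAddCommGroup E] [NormedSpace ℝ E] {F : E → ℝ}
    (hF : ContDiff ℝ (⊤ : ℕ∞) F) (e : E) :
    ContDiff ℝ (⊤ : ℕ∞) (fun p => fderiv ℝ F p e) :=
  (hF.fderiv_right (by simp)).clm_apply contDiff_const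

theorem fderiv_fderiv_apply_comm {E : Type*} [NormedAddCommGroup E] [NormedSpace ℝ E] {F : E → ℝ}
    (hF : ContDiff ℝ (⊤ : ℕ∞) F) (e e' p : E) :
    fderiv ℝ (fun q => fderiv ℝ F q e) p e' = fderiv ℝ (fun q => fderiv ℝ F q e') p e := by
  have hd : DifferentiableAt ℝ (fderiv ℝ F) p :=
    (hF.fderiv_right (m := (⊤ : ℕ∞)) (by simp)).differentiable (by simp) p
  have hs : IsSymmSndFDerivAt ℝ F p :=
    hF.contDiffAt.isSymmSndFDerivAt (by
      rw [minSmoothness_of_isRCLikeNormedField]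
      exact ENat.LEInfty.out)
  rw [fderiv_clm_apply hd (differentiableAt_const e),
    fderiv_clm_apply hd (differentiableAt_const e')]
  simpa using hs e' e

theorem pdx_slice {G : (Fin d → ℝ) × ℝ → ℝ} (hG : Differentiable ℝ G) (k : Fin d) (t : ℝ)
    (x : Fin d → ℝ) :
    pdx k (fun y => G (y, t)) x = fderiv ℝ G (x, t) (Pi.single k 1, 0) := by
  have h := (hG (x, t)).hasFDerivAt.comp x (hasFDerivAt_prodMk_left (𝕜 := ℝ) x t)
  have h' : HasFDerivAt (fun y => G (y, t)) _ x := h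
  rw [pdx, h'.fderiv]
  simp

theorem hasDerivAt_time_slice {G : (Fin d → ℝ) × ℝ → ℝ} (hG : Differentiable ℝ G)
    (x : Fin d → ℝ) (t : ℝ) :
    HasDerivAt (fun s => G (x, s)) (fderiv ℝ G (x, t) (0, 1)) t := by
  have h := (hG (x, t)).hasFDerivAt.comp t (hasFDerivAt_prodMk_right (𝕜 := ℝ) x t)
  have h' : HasDerivAt (fun s => G (x, s)) _ t := h.hasDerivAt
  convert h' using 1
  simp

theorem lapx_slice {G : (Fin d → ℝ) × ℝ → ℝ} (hG : ContDiff ℝ (⊤ : ℕ∞) G) (t : ℝ)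
    (x : Fin d → ℝ) :
    lapx (fun y => G (y, t)) x = ∑ k : Fin d,
      fderiv ℝ (fun q => fderiv ℝ G q (Pi.single k 1, 0)) (x, t) (Pi.single k 1, 0) := by
  refine Finset.sum_congr rfl fun k _ => ?_
  have : pdx k (fun y => G (y, t)) = fun y => fderiv ℝ G (y, t) (Pi.single k 1, 0) :=
    funext (pdx_slice (hG.differentiable (by simp)) k t)
  rw [this]
  exact pdx_slice ((contDiff_fderiv_apply hG _).differentiable (by simp)) k t x

theorem integrable_restrict_prod_of_continuous {G : (Fin d → ℝ) × ℝ → ℝ} (hG : Continuous G)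
    {Ω : Set (Fin d → ℝ)} (hb : Bornology.IsBounded Ω) (T : ℝ) :
    Integrable G ((volume.restrict Ω).prod (volume.restrict (Set.Ioo 0 T))) := by
  rw [Measure.prod_restrict]
  have hK : IsCompact (closure Ω ×ˢ Set.Icc 0 T) := hb.isCompact_closure.prod isCompact_Icc
  exact (hG.continuousOn.integrableOn_compact hK).mono_set
    (Set.prod_mono subset_closure Set.Ioo_subset_Icc_self)

theorem integral_integral_sub_sq {a b : (Fin d → ℝ) × ℝ → ℝ} (ha : Continuous a)
    (hb : Continuous b) {Ω : Set (Fin d → ℝ)} (hΩ : Bornology.IsBounded Ω) (T : ℝ) :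
    ∫ t in Set.Ioo 0 T, ∫ x in Ω,
        (a (x, t) * a (x, t) + b (x, t) * b (x, t) - a (x, t) * b (x, t) - b (x, t) * a (x, t))
      = (∫ t in Set.Ioo 0 T, ∫ x in Ω, a (x, t) ^ 2)
        + (∫ t in Set.Ioo 0 T, ∫ x in Ω, b (x, t) ^ 2)
        + ∫ t in Set.Ioo 0 T, ∫ x in Ω, -(2 * (a (x, t) * b (x, t))) := by
  have h1 := integrable_restrict_prod_of_continuous
    (G := fun p => a p ^ 2) (by fun_prop) hΩ T
  have h2 := integrable_restrict_prod_of_continuous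
    (G := fun p => b p ^ 2) (by fun_prop) hΩ T
  have h12 := integrable_restrict_prod_of_continuous
    (G := fun p => a p ^ 2 + b p ^ 2) (by fun_prop) hΩ T
  have h3 := integrable_restrict_prod_of_continuous
    (G := fun p => -(2 * (a p * b p))) (by fun_prop) hΩ T
  rw [← integral_prod_symm _ h1, ← integral_prod_symm _ h2, ← integral_prod_symm _ h3,
    ← integral_add h1 h2, ← integral_add h12 h3,
    integral_prod_symm _ (h12.fun_add h3)]
  congr! 4 with t x
  ring

theorem integral_time_deriv_gradSq_eq {F : (Fin d → ℝ) × ℝ → ℝ} (hF : ContDiff ℝ (⊤ : ℕ∞) F)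
    {Ω : Set (Fin d → ℝ)} (ho : IsOpen Ω) (hb : Bornology.IsBounded Ω) {t : ℝ}
    (h0 : ∀ x ∈ frontier Ω, fderiv ℝ F (x, t) (0, 1) = 0) :
    ∫ x in Ω, fderiv ℝ (fun q => ∑ k : Fin d, (fderiv ℝ F q (Pi.single k 1, 0)) ^ 2) (x, t) (0, 1)
      = ∫ x in Ω, -(2 * (fderiv ℝ F (x, t) (0, 1) * ∑ k : Fin d,
          fderiv ℝ (fun q => fderiv ℝ F q (Pi.single k 1, 0)) (x, t) (Pi.single k 1, 0))) := by
  have ha := contDiff_fderiv_apply hF (0, 1)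
  have hc := fun k : Fin d => contDiff_fderiv_apply hF (Pi.single k 1, 0)
  have hslice : ContDiff ℝ (⊤ : ℕ∞) (fun x : Fin d → ℝ => (x, t)) :=
    contDiff_id.prodMk contDiff_const
  let g : Fin d → (Fin d → ℝ) × ℝ → ℝ := fun k q =>
    fderiv ℝ F q (0, 1) * fderiv ℝ F q (Pi.single k 1, 0)
  have hg : ∀ k, ContDiff ℝ (⊤ : ℕ∞) (g k) := fun k => ha.mul (hc k)
  have hgk : ∀ k, ∫ x in Ω, fderiv ℝ (g k) (x, t) (Pi.single k 1, 0) = 0 := by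
    intro k
    have := integral_fderiv_eq_zero_of_eq_zero_on_frontier volume
      (g := fun x => g k (x, t)) (((hg k).comp hslice).of_le ENat.LEInfty.out) ho hb
      (fun x hx => by simp [g, h0 x hx]) (Pi.single k 1)
    refine Eq.trans ?_ this
    exact integral_congr_ae (.of_forall fun x =>
      (pdx_slice ((hg k).differentiable (by simp)) k t x).symm)
  have hintegrable : ∀ {H : (Fin d → ℝ) × ℝ → ℝ}, Continuous H →
      IntegrableOn (fun x => H (x, t)) Ω := fun hH =>
    ((hH.comp hslice.continuous).continuousOn.integrableOn_compact
      hb.isCompact_closure).mono_set subset_closure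
  have hgi : ∀ k, IntegrableOn (fun x => fderiv ℝ (g k) (x, t) (Pi.single k 1, 0)) Ω := fun k =>
    hintegrable (contDiff_fderiv_apply (hg k) _).continuous
  have hsum : ∫ x in Ω, 2 * ∑ k, fderiv ℝ (g k) (x, t) (Pi.single k 1, 0) = 0 := by
    rw [integral_const_mul, integral_finsetSum _ fun k _ => hgi k]
    simp [hgk]
  rw [← sub_eq_zero, ← integral_sub]
  · refine Eq.trans ?_ hsum
    refine integral_congr_ae (.of_forall fun x => ?_)
    have hdc : ∀ k, DifferentiableAt ℝ (fun q => fderiv ℝ F q (Pi.single k 1, 0)) (x, t) :=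
      fun k => (hc k).differentiable (by simp) _
    have hda : DifferentiableAt ℝ (fun q => fderiv ℝ F q (0, 1)) (x, t) :=
      ha.differentiable (by simp) _
    simp only [g]
    rw [fderiv_fun_sum fun k _ => (hdc k).fun_pow 2]
    simp only [_root_.sum_apply]
    rw [sub_neg_eq_add, Finset.mul_sum, Finset.mul_sum, Finset.mul_sum, ← Finset.sum_add_distrib]
    refine Finset.sum_congr rfl fun k _ => ?_
    rw [fderiv_fun_mul hda (hdc k), fderiv_fun_pow 2 (hdc k)]
    simp only [_root_.add_apply, _root_.smul_apply, smul_eq_mul]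
    rw [fderiv_fderiv_apply_comm hF (Pi.single k 1, 0) (0, 1)]
    simp
    ring
  · exact hintegrable (contDiff_fderiv_apply (ContDiff.sum fun k _ => (hc k).pow 2) _).continuous
  · exact hintegrable ((continuous_const.mul (ha.continuous.mul (continuous_finsetSum _ fun k _ =>
      (contDiff_fderiv_apply (hc k) _).continuous))).neg)

theorem integral_integral_time_deriv {G : (Fin d → ℝ) × ℝ → ℝ} (hG : ContDiff ℝ (⊤ : ℕ∞) G)
    {Ω : Set (Fin d → ℝ)} (ho : IsOpen Ω) (hb : Bornology.IsBounded Ω) {T : ℝ} (hT : 0 ≤ T)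
    (h0 : ∀ x ∈ Ω, G (x, 0) = 0) :
    ∫ t in Set.Ioo 0 T, ∫ x in Ω, fderiv ℝ G (x, t) (0, 1) = ∫ x in Ω, G (x, T) := by
  have hc := (contDiff_fderiv_apply hG (0, 1)).continuous
  rw [← integral_integral_swap (f := fun x t => fderiv ℝ G (x, t) (0, 1))
    (integrable_restrict_prod_of_continuous hc hb T)]
  refine setIntegral_congr_fun ho.measurableSet fun x hx => ?_
  rw [← integral_Ioc_eq_integral_Ioo, ← intervalIntegral.integral_of_le hT,
    intervalIntegral.integral_eq_sub_of_hasDerivAt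
      (fun t _ => hasDerivAt_time_slice (hG.differentiable (by simp)) x t)
      ((hc.comp (Continuous.prodMk_right x)).intervalIntegrable _ _), h0 x hx, sub_zero]

end SpaceTimeSlices

/-- Lemma 3.2 (coercivity): if `v` is smooth, vanishes on `∂Ω × [0,T]` and at `t = 0`, then
`A(v,v) = ∫₀ᵀ∫_Ω |∂ₜv|² + ∫₀ᵀ∫_Ω |Δv|² + ∫_Ω |∇v(x,T)|²` and in particular
`A(v,v) ≥ ‖v‖²_{V₀}`. -/
theorem coercivity_of_spacetime_bilinear_form
    {d : ℕ} (Ω : Set (Fin d → ℝ)) (hΩo : IsOpen Ω) (hΩb : Bornology.IsBounded Ω)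
    (T : ℝ) (hT : 0 < T) (v : (Fin d → ℝ) → ℝ → ℝ)
    (hv : ContDiff ℝ (⊤ : ℕ∞) (Function.uncurry v))
    (hbc : ∀ x ∈ frontier Ω, ∀ t ∈ Set.Icc (0:ℝ) T, v x t = 0)
    (hic : ∀ x ∈ Ω, v x 0 = 0) :
    Abil Ω T v v
        = (∫ t in Set.Ioo (0:ℝ) T, ∫ x in Ω, (pdt v x t) ^ 2)
          + (∫ t in Set.Ioo (0:ℝ) T, ∫ x in Ω, (lapx (fun y => v y t) x) ^ 2)
          + ∫ x in Ω, gradSq (fun y => v y T) x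
      ∧ Vsq Ω T v ≤ Abil Ω T v v := by
  set F := Function.uncurry v
  have hFd : Differentiable ℝ F := hv.differentiable (by simp)
  have hpdt : ∀ x t, pdt v x t = fderiv ℝ F (x, t) (0, 1) := fun x t =>
    (hasDerivAt_time_slice hFd x t).deriv
  have hlap : ∀ x t, lapx (fun y => v y t) x = _ := fun x t => lapx_slice hv t x
  have hpdx : ∀ k t x, pdx k (fun y => v y t) x = _ := fun k t x => pdx_slice hFd k t x
  have hac := (contDiff_fderiv_apply hv (0, 1)).continuous
  have hbC : Continuous fun p : (Fin d → ℝ) × ℝ => ∑ k : Fin d,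
      fderiv ℝ (fun q => fderiv ℝ F q (Pi.single k 1, 0)) p (Pi.single k 1, 0) :=
    continuous_finsetSum _ fun k _ =>
      (contDiff_fderiv_apply (contDiff_fderiv_apply hv (Pi.single k 1, 0)) _).continuous
  have hpdt0 : ∀ t ∈ Set.Ioo 0 T, ∀ x ∈ frontier Ω, fderiv ℝ F (x, t) (0, 1) = 0 := by
    intro t ht x hx
    rw [← hpdt, pdt]
    have : v x =ᶠ[nhds t] fun _ => 0 :=
      Filter.eventually_of_mem (Ioo_mem_nhds ht.1 ht.2)
        fun s hs => hbc x hx s (Set.Ioo_subset_Icc_self hs)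
    rw [this.deriv_eq, deriv_const]
  have hgrad0 : ∀ x ∈ Ω, ∑ k : Fin d, (fderiv ℝ F (x, 0) (Pi.single k 1, 0)) ^ 2 = 0 := by
    intro x hx
    refine Finset.sum_eq_zero fun k _ => ?_
    have : (fun y => v y 0) =ᶠ[nhds x] fun _ => 0 :=
      Filter.eventually_of_mem (hΩo.mem_nhds hx) hic
    rw [← hpdx, pdx, this.fderiv_eq]
    simp
  have hcross := integral_integral_time_deriv
    (ContDiff.sum fun (k : Fin d) _ => (contDiff_fderiv_apply hv (Pi.single k 1, 0)).pow 2)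
    hΩo hΩb hT.le hgrad0
  rw [setIntegral_congr_fun measurableSet_Ioo fun t ht =>
    integral_time_deriv_gradSq_eq hv hΩo hΩb (hpdt0 t ht)] at hcross
  have hgrad : ∫ x in Ω, gradSq (fun y => v y T) x
      = ∫ x in Ω, ∑ k : Fin d, (fderiv ℝ F (x, T) (Pi.single k 1, 0)) ^ 2 := by
    simp only [gradSq, hpdx]
  have hid : Abil Ω T v v
        = (∫ t in Set.Ioo (0:ℝ) T, ∫ x in Ω, (pdt v x t) ^ 2)
          + (∫ t in Set.Ioo (0:ℝ) T, ∫ x in Ω, (lapx (fun y => v y t) x) ^ 2)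
          + ∫ x in Ω, gradSq (fun y => v y T) x := by
    rw [hgrad, ← hcross]
    simp only [Abil, hpdt, hlap]
    exact integral_integral_sub_sq hac hbC hΩb T
  refine ⟨hid, ?_⟩
  have hnn : 0 ≤ ∫ x in Ω, gradSq (fun y => v y T) x :=
    integral_nonneg fun x => Finset.sum_nonneg fun k _ => sq_nonneg _
  rw [hid, Vsq]
  linarith
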